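/- Let c : ℝ³ → ℝ be continuous with c₀ ≤ c(x) ≤ c₁ for all x, where 0 < c₀ ≤ c₁ are constants. Let τ ≥ 0, let K ⊂ ℝ³ be compact, and let u : ℝ³ × [0,∞) → ℝ be twice continuously differentiable with u(·,t) supported in K for every t. Suppose u(x,0) = 0 and ∂t u(x,0) = 0 for all x, and that c(x)∂t²u(x,t) = Δu(x,t) + g(x,t) on ℝ³ × (0,τ) for a function g satisfying g(x,t) = 0 whenever t ≤ τ. Then u(x,t) = 0 for all x ∈ ℝ³ and all 0 ≤ t ≤ τ. -/

import Mathlib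

open Real Set

noncomputable section

/-- The Laplacian of a function on `ℝ³`: the sum of its second partial derivatives
in the three coordinate directions. -/
def laplacian3 (F : EuclideanSpace ℝ (Fin 3) → ℝ) (x : EuclideanSpace ℝ (Fin 3)) : ℝ :=
  ∑ i : Fin 3,
    iteratedDeriv 2 (fun s : ℝ => F (x + s • EuclideanSpace.single i (1 : ℝ))) 0

section Aux

open MeasureTheory Filter Topology

/-- Three-dimensional Euclidean space. -/
abbrev E3 := EuclideanSpace ℝ (Fin 3)

lemma aux_leibniz (K : Set E3) (hK : IsCompact K) (f f' : E3 → ℝ → ℝ)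
    (hf : ContinuousOn (fun p : E3 × ℝ => f p.1 p.2) (univ ×ˢ Ioi 0))
    (hf' : ContinuousOn (fun p : E3 × ℝ => f' p.1 p.2) (univ ×ˢ Ioi 0))
    (hd : ∀ x t, 0 < t → HasDerivAt (f x) (f' x t) t)
    (hz : ∀ x ∉ K, ∀ t, 0 < t → f x t = 0)
    (hz' : ∀ x ∉ K, ∀ t, 0 < t → f' x t = 0) (t : ℝ) (ht : 0 < t) :
    HasDerivAt (fun s => ∫ x, f x s) (∫ x, f' x t) t := by
  have sl : ∀ (h : E3 → ℝ → ℝ), ContinuousOn (fun p : E3 × ℝ => h p.1 p.2) (univ ×ˢ Ioi 0) →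
      ∀ s, 0 < s → Continuous (fun x => h x s) := by
    intro h hh s hs
    have : ContinuousOn (fun x : E3 => (x, s)) univ := by fun_prop
    rw [← continuousOn_univ]
    exact hh.comp this (fun x _ => ⟨mem_univ _, hs⟩)
  have cs : ∀ (h : E3 → ℝ → ℝ), (∀ x ∉ K, ∀ t, 0 < t → h x t = 0) →
      ∀ s, 0 < s → HasCompactSupport (fun x => h x s) := fun h hh s hs =>
    HasCompactSupport.intro hK (fun x hx => hh x hx s hs)
  obtain ⟨M, hM⟩ := (hK.prod (isCompact_Icc (a := t/2) (b := 2*t))).exists_bound_of_continuousOn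
    (hf'.mono (fun p hp => ⟨mem_univ _, lt_of_lt_of_le (by linarith : (0:ℝ) < t/2) hp.2.1⟩))
  have hpos : ∀ᶠ s in 𝓝 t, 0 < s := lt_mem_nhds ht
  have hnb : Ioo (t/2) (2*t) ∈ 𝓝 t := Ioo_mem_nhds (by linarith) (by linarith)
  refine (hasDerivAt_integral_of_dominated_loc_of_deriv_le (F := fun s x => f x s)
    (F' := fun s x => f' x s) (bound := K.indicator (fun _ => M)) hnb ?_ ?_ ?_ ?_ ?_ ?_).2
  · filter_upwards [hpos] with s hs using (sl f hf s hs).aestronglyMeasurable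
  · exact (sl f hf t ht).integrable_of_hasCompactSupport (cs f hz t ht)
  · exact (sl f' hf' t ht).aestronglyMeasurable
  · refine Eventually.of_forall fun x s hs => ?_
    have hs0 : 0 < s := by linarith [hs.1]
    by_cases hx : x ∈ K
    · simpa [hx] using hM (x, s) ⟨hx, hs.1.le, hs.2.le⟩
    · simp [hx, hz' x hx s hs0]
  · rw [integrable_indicator_iff hK.measurableSet]
    exact integrableOn_const hK.measure_lt_top.ne
  · refine Eventually.of_forall fun x s hs => hd x s (by linarith [hs.1])

lemma aux_iter {V : Type*} [NormedAddCommGroup V] [NormedSpace ℝ V] (U : V → ℝ)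
    (D : V → V →L[ℝ] ℝ) (D2 : V →L[ℝ] V →L[ℝ] ℝ) (γ : ℝ → V) (d : V) (s : ℝ)
    (hγ : ∀ r, HasDerivAt γ d r)
    (hU : ∀ᶠ p in 𝓝 (γ s), HasFDerivAt U (D p) p) (hD : HasFDerivAt D D2 (γ s)) :
    iteratedDeriv 2 (fun r => U (γ r)) s = D2 d d := by
  rw [iteratedDeriv_succ, iteratedDeriv_one]
  have h1 : deriv (fun r => U (γ r)) =ᶠ[𝓝 s] fun r => D (γ r) d := by
    filter_upwards [(hγ s).continuousAt.eventually hU] with r hr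
    exact (hr.comp_hasDerivAt r (hγ r)).deriv
  rw [h1.deriv_eq]
  have := (hD.comp_hasDerivAt s (hγ s)).clm_apply (hasDerivAt_const s d)
  simpa using this.deriv

/-- Derivatives of a function supported in `K` vanish off `K`. -/
lemma aux_zero (K : Set E3) (hK : IsCompact K) {F : Type*} [NormedAddCommGroup F] [NormedSpace ℝ F]
    (U : E3 × ℝ → F) (h : ∀ x ∉ K, ∀ t, 0 ≤ t → U (x, t) = 0) :
    ∀ x ∉ K, ∀ t, 0 ≤ t → fderivWithin ℝ U (univ ×ˢ Ici (0:ℝ)) (x, t) = 0 := by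
  intro x hx t ht
  have hn : Kᶜ ×ˢ (univ : Set ℝ) ∈ 𝓝 (x, t) :=
    (hK.isClosed.isOpen_compl.prod isOpen_univ).mem_nhds ⟨hx, mem_univ _⟩
  have : U =ᶠ[𝓝[univ ×ˢ Ici (0:ℝ)] (x, t)] fun _ => 0 := by
    filter_upwards [nhdsWithin_le_nhds hn, self_mem_nhdsWithin] with p hp hp2
    exact h p.1 hp.1 p.2 hp2.2
  rw [this.fderivWithin_eq (h x hx t ht)]
  simp

lemma aux_main
    (c : E3 → ℝ) (c₀ : ℝ) (hc₀ : 0 < c₀)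
    (hc_cont : Continuous c) (hc_bdd : ∀ x, c₀ ≤ c x)
    (τ : ℝ)
    (K : Set E3) (hK : IsCompact K)
    (u : E3 → ℝ → ℝ)
    (hu_smooth : ContDiffOn ℝ 2 (fun p : E3 × ℝ => u p.1 p.2) (Set.univ ×ˢ Set.Ici 0))
    (hu_supp : ∀ t : ℝ, ∀ x ∉ K, u x t = 0)
    (hu_init : ∀ x, u x 0 = 0)
    (hu_init' : ∀ x, derivWithin (u x) (Set.Ici 0) 0 = 0)
    (hpde : ∀ (x : E3), ∀ t ∈ Set.Ioo 0 τ,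
      c x * iteratedDeriv 2 (u x) t = laplacian3 (fun z => u z t) x) :
    ∀ (x : E3) (t : ℝ), 0 ≤ t → t ≤ τ → u x t = 0 := by
  set S : Set (E3 × ℝ) := univ ×ˢ Ici 0 with hS
  set U : E3 × ℝ → ℝ := fun p => u p.1 p.2 with hUdef
  have hSu : UniqueDiffOn ℝ S := uniqueDiffOn_univ.prod (uniqueDiffOn_Ici 0)
  obtain ⟨D, hDdef⟩ : ∃ D, D = fderivWithin ℝ U S := ⟨_, rfl⟩
  obtain ⟨D2, hD2def⟩ : ∃ D2, D2 = fderivWithin ℝ D S := ⟨_, rfl⟩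
  have hDs : ContDiffOn ℝ 1 D S := by
    rw [hDdef]; exact hu_smooth.fderivWithin hSu (by norm_num)
  have hD2c : ContinuousOn D2 S := by
    rw [hD2def]; exact hDs.continuousOn_fderivWithin hSu (by norm_num)
  have hDc : ContinuousOn D S := hDs.continuousOn
  have hUc : ContinuousOn U S := hu_smooth.continuousOn
  have hUw : ∀ p ∈ S, HasFDerivWithinAt U (D p) S p := fun p hp => by
    rw [hDdef]
    exact ((hu_smooth.differentiableOn (by norm_num)) p hp).hasFDerivWithinAt
  have hDw : ∀ p ∈ S, HasFDerivWithinAt D (D2 p) S p := fun p hp => by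
    rw [hD2def]
    exact ((hDs.differentiableOn (by norm_num)) p hp).hasFDerivWithinAt
  have hSn : ∀ p : E3 × ℝ, 0 < p.2 → S ∈ 𝓝 p := fun p hp =>
    prod_mem_nhds univ_mem (Ici_mem_nhds hp)
  have hSm : ∀ p : E3 × ℝ, 0 < p.2 → p ∈ S := fun p hp => mem_of_mem_nhds (hSn p hp)
  have hUd : ∀ p : E3 × ℝ, 0 < p.2 → HasFDerivAt U (D p) p := fun p hp =>
    (hUw p (hSm p hp)).hasFDerivAt (hSn p hp)
  have hDd : ∀ p : E3 × ℝ, 0 < p.2 → HasFDerivAt D (D2 p) p := fun p hp =>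
    (hDw p (hSm p hp)).hasFDerivAt (hSn p hp)
  have hUe : ∀ p : E3 × ℝ, 0 < p.2 → ∀ᶠ q in 𝓝 p, HasFDerivAt U (D q) q := fun p hp => by
    filter_upwards [(continuous_snd.tendsto p).eventually (lt_mem_nhds hp)] with q hq
    exact hUd q hq
  have hsym : ∀ p : E3 × ℝ, 0 < p.2 → ∀ v w, D2 p v w = D2 p w v := fun p hp v w =>
    second_derivative_symmetric_of_eventually (hUe p hp) (hDd p hp) v w
  have hDz : ∀ x ∉ K, ∀ t, 0 ≤ t → D (x, t) = 0 := by
    rw [hDdef]; exact aux_zero K hK U (fun x hx t _ => hu_supp t x hx)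
  have hD2z : ∀ x ∉ K, ∀ t, 0 ≤ t → D2 (x, t) = 0 := by
    rw [hD2def]; exact aux_zero K hK D hDz
  set e : Fin 3 → E3 × ℝ := fun i => (EuclideanSpace.single i (1 : ℝ), 0) with he
  set d : E3 × ℝ := (0, 1) with hd
  have hγt : ∀ (x : E3) (r : ℝ), HasDerivAt (fun s : ℝ => (x, s)) d r := fun x r =>
    (hasDerivAt_const r x).prodMk (hasDerivAt_id r)
  -- the equation
  have hpde' : ∀ x, ∀ t ∈ Ioo 0 τ, c x * D2 (x, t) d d = ∑ i, D2 (x, t) (e i) (e i) := by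
    intro x t ht
    have h1 := aux_iter U D (D2 (x, t)) (fun s : ℝ => (x, s)) d t (hγt x)
      (hUe (x, t) ht.1) (hDd (x, t) ht.1)
    have h2 : ∀ i : Fin 3, iteratedDeriv 2
        (fun s : ℝ => u (x + s • EuclideanSpace.single i (1 : ℝ)) t) 0
        = D2 (x, t) (e i) (e i) := by
      intro i
      have hx0 : (x + (0:ℝ) • EuclideanSpace.single i (1 : ℝ), t) = (x, t) := by simp
      refine aux_iter U D (D2 (x, t))
        (fun s : ℝ => (x + s • EuclideanSpace.single i (1 : ℝ), t)) (e i) 0 ?_ ?_ ?_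
      · intro r
        refine HasDerivAt.prodMk ?_ (hasDerivAt_const r t)
        simpa using ((hasDerivAt_id r).smul_const
          (EuclideanSpace.single i (1 : ℝ) : E3)).const_add x
      · simp only [hx0]; exact hUe (x, t) ht.1
      · simp only [hx0]; exact hDd (x, t) ht.1
    have h3 := hpde x t ht
    unfold laplacian3 at h3
    simp only [h2] at h3
    rw [← h3, ← h1]
  -- the energy density and its time derivative
  set f : E3 → ℝ → ℝ := fun x t => c x * (D (x, t) d) ^ 2 + ∑ i, (D (x, t) (e i)) ^ 2 with hf
  set f' : E3 → ℝ → ℝ := fun x t => c x * (2 * D (x, t) d * D2 (x, t) d d)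
    + ∑ i, 2 * D (x, t) (e i) * D2 (x, t) d (e i) with hf'
  have happ : ∀ v, ContinuousOn (fun p => D p v) S := fun v => hDc.clm_apply continuousOn_const
  have happ2 : ∀ v w, ContinuousOn (fun p => D2 p v w) S := fun v w =>
    (hD2c.clm_apply continuousOn_const).clm_apply continuousOn_const
  have hcc : ContinuousOn (fun p : E3 × ℝ => c p.1) S := (hc_cont.comp continuous_fst).continuousOn
  have hfc : ContinuousOn (fun p : E3 × ℝ => f p.1 p.2) S :=
    (hcc.mul ((happ d).pow 2)).add (continuousOn_finsetSum _ fun i _ => (happ (e i)).pow 2)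
  have hfc' : ContinuousOn (fun p : E3 × ℝ => f' p.1 p.2) S :=
    (hcc.mul ((continuousOn_const.mul (happ d)).mul (happ2 d d))).add
      (continuousOn_finsetSum _ fun i _ =>
        (continuousOn_const.mul (happ (e i))).mul (happ2 d (e i)))
  have hsub : (univ ×ˢ Ioi (0:ℝ) : Set (E3 × ℝ)) ⊆ S := fun p hp => ⟨hp.1, Ioi_subset_Ici_self hp.2⟩
  have hdt : ∀ x t, 0 < t → ∀ v, HasDerivAt (fun s => D (x, s) v) (D2 (x, t) d v) t := by
    intro x t ht v
    have := ((hDd (x, t) ht).comp_hasDerivAt t (hγt x t)).clm_apply (hasDerivAt_const t v)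
    simpa using this
  have hfd : ∀ x t, 0 < t → HasDerivAt (f x) (f' x t) t := by
    intro x t ht
    have h1 := ((hdt x t ht d).fun_pow 2).const_mul (c x)
    have h2 : HasDerivAt (fun s => ∑ i, (D (x, s) (e i)) ^ 2)
        (∑ i, 2 * D (x, t) (e i) * D2 (x, t) d (e i)) t := by
      refine HasDerivAt.fun_sum fun i _ => ?_
      simpa using (hdt x t ht (e i)).fun_pow 2
    simpa [hf, hf'] using h1.fun_add h2
  have hfz : ∀ x ∉ K, ∀ t, 0 ≤ t → f x t = 0 := fun x hx t ht => by
    simp [hf, hDz x hx t ht]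
  have hfz' : ∀ x ∉ K, ∀ t, 0 ≤ t → f' x t = 0 := fun x hx t ht => by
    simp [hf', hDz x hx t ht]
  have hE : ∀ t, 0 < t → HasDerivAt (fun s => ∫ x, f x s) (∫ x, f' x t) t := fun t ht =>
    aux_leibniz K hK f f' (hfc.mono hsub) (hfc'.mono hsub) hfd
      (fun x hx t ht => hfz x hx t ht.le) (fun x hx t ht => hfz' x hx t ht.le) t ht
  have sl : ∀ (h : E3 × ℝ → ℝ), ContinuousOn h S →
      ∀ s, 0 ≤ s → Continuous (fun x => h (x, s)) := by
    intro h hh s hs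
    have : ContinuousOn (fun x : E3 => (x, s)) univ := by fun_prop
    rw [← continuousOn_univ]
    exact hh.comp this (fun x _ => ⟨mem_univ _, hs⟩)
  have hintg : ∀ (h : E3 × ℝ → ℝ), ContinuousOn h S → ∀ s, 0 ≤ s → (∀ x ∉ K, h (x, s) = 0) →
      Integrable (fun x => h (x, s)) := fun h hh s hs hz =>
    (sl h hh s hs).integrable_of_hasCompactSupport (HasCompactSupport.intro hK hz)
  -- integration by parts
  have hdx : ∀ x t, 0 < t → ∀ v, HasFDerivAt (fun z => D (z, t) v)
      (((D2 (x, t)).flip v).comp (ContinuousLinearMap.inl ℝ E3 ℝ)) x := by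
    intro x t ht v
    have h1 : HasFDerivAt (fun z : E3 => (z, t)) (ContinuousLinearMap.inl ℝ E3 ℝ) x :=
      hasFDerivAt_prodMk_left x t
    have h2 := (HasFDerivAt.comp x (hDd (x, t) ht) h1).clm_apply (hasFDerivAt_const v x)
    refine h2.congr_fderiv ?_
    ext z
    simp
  have hibp : ∀ t, 0 < t → ∀ i, ∫ x, D (x, t) d * D2 (x, t) (e i) (e i)
      = - ∫ x, D2 (x, t) (e i) d * D (x, t) (e i) := by
    intro t ht i
    have hv : ∀ x v, fderiv ℝ (fun z => D (z, t) v) x (EuclideanSpace.single i (1 : ℝ))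
        = D2 (x, t) (e i) v := by
      intro x v
      rw [(hdx x t ht v).fderiv]
      simp [he]
    have := integral_mul_fderiv_eq_neg_fderiv_mul_of_integrable (μ := (volume : Measure E3))
      (f := fun z => D (z, t) d) (g := fun z => D (z, t) (e i))
      (v := EuclideanSpace.single i (1 : ℝ)) ?_ ?_ ?_
      (fun x _ => (hdx x t ht _).differentiableAt) (fun x _ => (hdx x t ht _).differentiableAt)
    · simpa only [hv] using this
    · simp only [hv]
      exact hintg (fun p => D2 p (e i) d * D p (e i)) ((happ2 _ _).mul (happ _)) t ht.le
        (fun x hx => by simp [hDz x hx t ht.le])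
    · simp only [hv]
      exact hintg (fun p => D p d * D2 p (e i) (e i)) ((happ _).mul (happ2 _ _)) t ht.le
        (fun x hx => by simp [hDz x hx t ht.le])
    · exact hintg (fun p => D p d * D p (e i)) ((happ _).mul (happ _)) t ht.le
        (fun x hx => by simp [hDz x hx t ht.le])
  have hE0 : ∀ t ∈ Ioo 0 τ, ∫ x, f' x t = 0 := by
    intro t ht
    have h1 : ∀ x, f' x t = ∑ i, (2 * (D (x, t) d * D2 (x, t) (e i) (e i))
        + 2 * (D2 (x, t) (e i) d * D (x, t) (e i))) := by
      intro x
      have h2 : c x * (2 * D (x, t) d * D2 (x, t) d d)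
          = 2 * D (x, t) d * ∑ i, D2 (x, t) (e i) (e i) := by
        rw [← hpde' x t ht]; ring
      simp only [hf']
      rw [h2, Finset.mul_sum, ← Finset.sum_add_distrib]
      refine Finset.sum_congr rfl fun i _ => ?_
      rw [hsym (x, t) ht.1 d (e i)]; ring
    have i1 : ∀ i, Integrable (fun x => 2 * (D (x, t) d * D2 (x, t) (e i) (e i))) := fun i =>
      (hintg (fun p => D p d * D2 p (e i) (e i)) ((happ _).mul (happ2 _ _)) t ht.1.le
        (fun x hx => by simp [hDz x hx t ht.1.le])).const_mul 2
    have i2 : ∀ i, Integrable (fun x => 2 * (D2 (x, t) (e i) d * D (x, t) (e i))) := fun i =>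
      (hintg (fun p => D2 p (e i) d * D p (e i)) ((happ2 _ _).mul (happ _)) t ht.1.le
        (fun x hx => by simp [hDz x hx t ht.1.le])).const_mul 2
    simp only [h1]
    rw [integral_finsetSum _ (fun i _ => Integrable.fun_add (i1 i) (i2 i))]
    refine Finset.sum_eq_zero fun i _ => ?_
    rw [integral_add (i1 i) (i2 i), integral_const_mul, integral_const_mul, hibp t ht.1 i]
    ring
  have hEc : ContinuousOn (fun s => ∫ x, f x s) (Ici 0) := by
    refine continuousOn_integral_of_compact_support (f := fun s x => f x s) hK ?_ ?_
    · have : ContinuousOn (fun q : ℝ × E3 => (q.2, q.1)) (Ici 0 ×ˢ univ) := by fun_prop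
      exact hfc.comp this (fun q hq => ⟨mem_univ _, hq.1⟩)
    · intro s x hs hx
      exact hfz x hx s hs
  -- initial data
  have hd0 : ∀ x, ∀ t, 0 ≤ t → HasDerivWithinAt (u x) (D (x, t) d) (Ici 0) t := by
    intro x t ht
    exact (hUw (x, t) ⟨mem_univ _, ht⟩).comp_hasDerivWithinAt t (hγt x t).hasDerivWithinAt
      (fun s hs => ⟨mem_univ _, hs⟩)
  have hDd0 : ∀ x, D (x, 0) d = 0 := fun x => by
    exact ((hd0 x 0 le_rfl).derivWithin (uniqueDiffOn_Ici 0 0 self_mem_Ici)).symm.trans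
      (hu_init' x)
  have hDe0 : ∀ x i, D (x, 0) (e i) = 0 := by
    intro x i
    have hx0 : (x + (0:ℝ) • EuclideanSpace.single i (1 : ℝ), (0:ℝ)) = (x, 0) := by simp
    have hγ : HasDerivAt (fun s : ℝ => (x + s • EuclideanSpace.single i (1 : ℝ), (0:ℝ)))
        (e i) 0 := by
      refine HasDerivAt.prodMk ?_ (hasDerivAt_const _ _)
      simpa using ((hasDerivAt_id (0:ℝ)).smul_const
          (EuclideanSpace.single i (1 : ℝ) : E3)).const_add x
    have h1 := hUw (x, 0) ⟨mem_univ _, self_mem_Ici⟩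
    rw [← hx0] at h1
    have h2 := HasFDerivWithinAt.comp_hasDerivWithinAt (s := univ)
      (f := fun s : ℝ => (x + s • EuclideanSpace.single i (1 : ℝ), (0:ℝ))) 0 h1 hγ.hasDerivWithinAt
      (fun s _ => ⟨mem_univ _, self_mem_Ici⟩)
    have h3 : HasDerivWithinAt (fun _ : ℝ => (0:ℝ)) (D (x, 0) (e i)) univ 0 := by
      rw [hx0] at h2
      refine h2.congr (fun s _ => ?_) ?_ <;> simp [hUdef, hu_init]
    exact (h3.hasDerivAt univ_mem).unique (hasDerivAt_const _ _)
  have hEz : ∀ t ∈ Ioo 0 τ, ∫ x, f x t = 0 := by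
    intro t ht
    have h0 : ∫ x, f x 0 = 0 := by simp [hf, hDd0, hDe0]
    obtain ⟨s, hs, hs2⟩ := exists_hasDerivAt_eq_slope (fun s => ∫ x, f x s)
      (fun s => ∫ x, f' x s) ht.1 (hEc.mono Icc_subset_Ici_self) (fun s hs => hE s hs.1)
    rw [hE0 s ⟨hs.1, hs.2.trans ht.2⟩, h0, sub_zero, sub_zero, eq_comm,
      div_eq_zero_iff] at hs2
    exact hs2.resolve_right ht.1.ne'
  have hvz : ∀ x, ∀ t ∈ Ioo 0 τ, D (x, t) d = 0 := by
    intro x t ht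
    have hnn : ∀ z, 0 ≤ c z * (D (z, t) d) ^ 2 := fun z =>
      mul_nonneg (hc₀.le.trans (hc_bdd z)) (sq_nonneg _)
    have hnn2 : ∀ z, 0 ≤ ∑ i, (D (z, t) (e i)) ^ 2 := fun z =>
      Finset.sum_nonneg fun i _ => sq_nonneg _
    have hfx : f x t = 0 := by
      by_contra hne
      have := integral_pos_of_integrable_nonneg_nonzero (μ := (volume : Measure E3))
        (f := fun z => f z t) (x := x) (sl _ hfc t ht.1.le)
        (hintg _ hfc t ht.1.le (fun z hz => hfz z hz t ht.1.le))
        (fun z => add_nonneg (hnn z) (hnn2 z)) hne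
      rw [hEz t ht] at this
      exact lt_irrefl _ this
    have h1 : c x * (D (x, t) d) ^ 2 = 0 :=
      le_antisymm (by have := hnn2 x; simp only [hf] at hfx; linarith) (hnn x)
    have hcx : c x ≠ 0 := (hc₀.trans_le (hc_bdd x)).ne'
    simpa [hcx] using h1
  intro x t ht htτ
  rcases ht.eq_or_lt with rfl | ht'
  · exact hu_init x
  obtain ⟨s, hs, hs2⟩ := exists_hasDerivAt_eq_slope (u x) (fun s => D (x, s) d) ht'
    (fun s hs => ((hd0 x s hs.1).continuousWithinAt).mono Icc_subset_Ici_self)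
    (fun s hs => (hd0 x s hs.1.le).hasDerivAt (Ici_mem_nhds hs.1))
  rw [hvz x s ⟨hs.1, hs.2.trans_le htτ⟩, hu_init, sub_zero, sub_zero, eq_comm,
    div_eq_zero_iff] at hs2
  exact hs2.resolve_right ht'.ne'

end Aux

/-- the energy-estimate vanishing statement (2.11) of the paper:
a compactly supported `C²` solution of `c(x)u_tt = Δu + g` with zero Cauchy data
and a source `g` vanishing for `t ≤ τ` must vanish for `0 ≤ t ≤ τ`. -/
theorem sobolev_energy_vanishing_before_source
    (c : EuclideanSpace ℝ (Fin 3) → ℝ) (c₀ c₁ : ℝ)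
    (hc₀ : 0 < c₀) (hc₀₁ : c₀ ≤ c₁)
    (hc_cont : Continuous c) (hc_bdd : ∀ x, c x ∈ Set.Icc c₀ c₁)
    (τ : ℝ) (hτ : 0 ≤ τ)
    (K : Set (EuclideanSpace ℝ (Fin 3))) (hK : IsCompact K)
    (u g : EuclideanSpace ℝ (Fin 3) → ℝ → ℝ)
    (hu_smooth : ContDiffOn ℝ 2 (fun p : EuclideanSpace ℝ (Fin 3) × ℝ => u p.1 p.2)
      (Set.univ ×ˢ Set.Ici 0))
    (hu_supp : ∀ t : ℝ, ∀ x ∉ K, u x t = 0)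
    (hu_init : ∀ x, u x 0 = 0)
    (hu_init' : ∀ x, derivWithin (u x) (Set.Ici 0) 0 = 0)
    (hg : ∀ (x : EuclideanSpace ℝ (Fin 3)) (t : ℝ), t ≤ τ → g x t = 0)
    (hpde : ∀ (x : EuclideanSpace ℝ (Fin 3)), ∀ t ∈ Set.Ioo 0 τ,
      c x * iteratedDeriv 2 (u x) t = laplacian3 (fun z => u z t) x + g x t) :
    ∀ (x : EuclideanSpace ℝ (Fin 3)) (t : ℝ), 0 ≤ t → t ≤ τ → u x t = 0 := by
  exact aux_main c c₀ hc₀ hc_cont (fun x => (hc_bdd x).1) τ K hK u hu_smooth hu_supp hu_init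
    hu_init' (fun x t ht => by rw [hpde x t ht, hg x t ht.2.le, add_zero])
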